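/- Let q be a prime with q ≡ 1 (mod 6) or q = 3, and let s be an integer with q ∣ Φ₃(s), where Φ₃(x) = x² + x + 1. Define n₆(x) = q·x² + (2s + 1)·x + Φ₃(s)/q, p₆(x) = Φ₄(q·x + s) with Φ₄(x) = x² + 1, and t₆(x) = 1 − q·x − s. Then for every integer x: (i) q·n₆(x) = p₆(x) + 1 − t₆(x); (ii) q·n₆(x) divides Φ₆(p₆(x)), where Φ₆(x) = x² − x + 1; (iii) t₆(x)² − 4·p₆(x) ≤ 0. Moreover n₆ and p₆ are irreducible as polynomials over ℤ. -/

import Mathlib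

open Polynomial

/-- The 3rd cyclotomic polynomial, evaluated at an integer. -/
def Phi3 (x : ℤ) : ℤ := x ^ 2 + x + 1

/-- The 4th cyclotomic polynomial, evaluated at an integer. -/
def Phi4 (x : ℤ) : ℤ := x ^ 2 + 1

/-- The 6th cyclotomic polynomial, evaluated at an integer. -/
def Phi6 (x : ℤ) : ℤ := x ^ 2 - x + 1

/-- A primitive integer quadratic polynomial with negative discriminant is irreducible. -/
theorem irreducible_quadratic_of_discrim_neg {a b c : ℤ}
    (hprim : ∀ u : ℤ, u ∣ a → u ∣ b → u ∣ c → IsUnit u) (hdisc : discrim a b c < 0) :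
    Irreducible (C a * X ^ 2 + C b * X + C c : ℤ[X]) := by
  have ha : a ≠ 0 := by
    rintro rfl
    simp only [discrim] at hdisc
    nlinarith [sq_nonneg b]
  have hdeg : (C a * X ^ 2 + C b * X + C c : ℤ[X]).natDegree = 2 := natDegree_quadratic ha
  have hunit : ∀ g h : ℤ[X], C a * X ^ 2 + C b * X + C c = g * h → g.natDegree = 0 →
      IsUnit g := by
    intro g h hgh hg
    obtain ⟨u, rfl⟩ := natDegree_eq_zero.mp hg
    have hu : ∀ n, u ∣ (C a * X ^ 2 + C b * X + C c : ℤ[X]).coeff n :=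
      C_dvd_iff_dvd_coeff u _ |>.mp ⟨h, hgh⟩
    refine isUnit_C.mpr (hprim u ?_ ?_ ?_)
    · simpa [coeff_X, coeff_C, -eq_intCast, -map_mul, -map_add] using hu 2
    · simpa [coeff_X, coeff_C, -eq_intCast, -map_mul, -map_add] using hu 1
    · simpa [coeff_X, coeff_C, -eq_intCast, -map_mul, -map_add] using hu 0
  refine ⟨fun h => ?_, fun g h hgh => ?_⟩
  · have := natDegree_eq_zero_of_isUnit h
    omega
  have hne : g * h ≠ 0 := by
    rw [← hgh]
    intro h0
    rw [h0, natDegree_zero] at hdeg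
    omega
  have hsum : g.natDegree + h.natDegree = 2 := by
    rw [← natDegree_mul (left_ne_zero_of_mul hne) (right_ne_zero_of_mul hne), ← hgh, hdeg]
  by_cases hg : g.natDegree = 0
  · exact Or.inl (hunit g h hgh hg)
  by_cases hh : h.natDegree = 0
  · exact Or.inr (hunit h g (hgh.trans (mul_comm g h)) hh)
  exfalso
  obtain ⟨u, v, rfl⟩ := exists_eq_X_add_C_of_natDegree_le_one (p := g) (by omega)
  obtain ⟨w, z, rfl⟩ := exists_eq_X_add_C_of_natDegree_le_one (p := h) (by omega)
  have hprod : (C u * X + C v) * (C w * X + C z) =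
      (C (u * w) * X ^ 2 + C (u * z + v * w) * X + C (v * z) : ℤ[X]) := by
    simp only [map_mul, map_add]
    ring
  rw [hprod] at hgh
  have h2 : a = u * w := by simpa [coeff_X, coeff_C, -eq_intCast, -map_mul, -map_add] using congrArg (coeff · 2) hgh
  have h1 : b = u * z + v * w := by simpa [coeff_X, coeff_C, -eq_intCast, -map_mul, -map_add] using congrArg (coeff · 1) hgh
  have h0 : c = v * z := by simpa [coeff_X, coeff_C, -eq_intCast, -map_mul, -map_add] using congrArg (coeff · 0) hgh
  subst h2 h1 h0
  simp only [discrim] at hdisc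
  nlinarith [sq_nonneg (u * z - v * w)]

theorem mnt_family_k6_case_phi3 (q : ℤ) (hq : Prime q) (hmod : q % 6 = 1 ∨ q = 3)
    (s : ℤ) (hdvd : q ∣ Phi3 s)
    (n6 : ℤ → ℤ) (hn6 : ∀ x, n6 x = q * x ^ 2 + (2 * s + 1) * x + Phi3 s / q)
    (p6 : ℤ → ℤ) (hp6 : ∀ x, p6 x = Phi4 (q * x + s))
    (t6 : ℤ → ℤ) (ht6 : ∀ x, t6 x = 1 - q * x - s) :
    (∀ x : ℤ, q * n6 x = p6 x + 1 - t6 x) ∧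
    (∀ x : ℤ, q * n6 x ∣ Phi6 (p6 x)) ∧
    (∀ x : ℤ, t6 x ^ 2 - 4 * p6 x ≤ 0) ∧
    Irreducible (C q * X ^ 2 + C (2 * s + 1) * X + C (Phi3 s / q)) ∧
    Irreducible ((C q * X + C s) ^ 2 + 1) := by
  obtain ⟨c, hc⟩ := hdvd
  have hdiv : Phi3 s / q = c := by rw [hc, Int.mul_ediv_cancel_left c hq.ne_zero]
  rw [hdiv] at hn6 ⊢
  simp only [Phi3] at hc
  have hn : ∀ x, q * n6 x = (q * x + s) ^ 2 + (q * x + s) + 1 := fun x => by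
    rw [hn6]
    linear_combination -hc
  refine ⟨fun x => ?_, fun x => ?_, fun x => ?_, ?_, ?_⟩
  · rw [hn, hp6, ht6, Phi4]
    ring
  · rw [hn, hp6, Phi4, Phi6]
    exact ⟨(q * x + s) ^ 2 - (q * x + s) + 1, by ring⟩
  · rw [hp6, ht6, Phi4]
    nlinarith [sq_nonneg (q * x + s + 1), sq_nonneg (q * x + s)]
  · refine irreducible_quadratic_of_discrim_neg (fun u hu1 hu2 hu3 => ?_) ?_
    · have h3 : u * u ∣ 3 := by
        have h : (3 : ℤ) = 4 * (q * c) - (2 * s + 1) * (2 * s + 1) := by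
          linear_combination 4 * hc
        rw [h]
        exact dvd_sub (dvd_mul_of_dvd_right (mul_dvd_mul hu1 hu3) 4) (mul_dvd_mul hu2 hu2)
      exact Int.prime_three.irreducible.squarefree u h3
    · simp only [discrim]
      linarith
  · have hp : ((C q * X + C s) ^ 2 + 1 : ℤ[X]) =
        C (q ^ 2) * X ^ 2 + C (2 * q * s) * X + C (s ^ 2 + 1) := by
      simp only [map_mul, map_add, map_pow, map_one, map_ofNat]
      ring
    rw [hp]
    refine irreducible_quadratic_of_discrim_neg (fun u hu1 _ hu3 => ?_) ?_
    · have hcop : IsCoprime q (s ^ 2 + 1) := ⟨-(s * c), 1 + s, by linear_combination s * hc⟩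
      exact hcop.pow_left.isUnit_of_dvd' hu1 hu3
    · have := pow_pos (abs_pos.mpr hq.ne_zero) 2
      rw [sq_abs] at this
      simp only [discrim]
      nlinarith
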